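/- arXiv:1912.12862 — 3 statements merged into one kernel-verified Lean document; each statement's English description precedes it below -/
import Mathlib

section
/- Let Z and (X_n)_{n∈ℤ} be random variables on a common probability space, taking values in measurable spaces F and E respectively, and set Y_n := X_{n+1} for each n. If the law of the sequence (X_n)_{n∈ℤ} on E^ℤ is ergodic with respect to the shift map, and the pair (Z, (Y_n)_{n∈ℤ}) has the same joint distribution as (Z, (X_n)_{n∈ℤ}), then Z is independent of the sequence (X_n)_{n∈ℤ}. -/
open MeasureTheory Filter

/-- If `(Xₙ)_{n∈ℤ}` has ergodic law w.r.t. the shift and `(Z, (X_{n+1})ₙ)`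
has the same joint distribution as `(Z, (Xₙ)ₙ)`, then `Z` is independent of `(Xₙ)ₙ`. -/
theorem indep_of_shift_invariant_of_ergodic
    {Ω E F : Type*} [MeasurableSpace Ω] [MeasurableSpace E] [MeasurableSpace F]
    (μ : Measure Ω) [IsProbabilityMeasure μ]
    (X : ℤ → Ω → E) (Z : Ω → F)
    (hX : ∀ n, Measurable (X n)) (hZ : Measurable Z)
    (S : (ℤ → E) → ℤ → E) (hS : ∀ x n, S x n = x (n + 1))
    (herg : Ergodic S (μ.map (fun ω => fun n => X n ω)))
    (hdist : μ.map (fun ω => (Z ω, fun n => X (n + 1) ω)) =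
             μ.map (fun ω => (Z ω, fun n => X n ω))) :
    ProbabilityTheory.IndepFun Z (fun ω => fun n => X n ω) μ := by
  have hXm : Measurable (fun ω => fun n => X n ω) := measurable_pi_lambda _ hX
  have hYm : Measurable (fun ω => fun n => X (n + 1) ω) :=
    measurable_pi_lambda _ fun n => hX (n + 1)
  have hSm : Measurable S := herg.measurable
  rw [ProbabilityTheory.indepFun_iff_measure_inter_preimage_eq_mul]
  intro B A hB hA
  set ν := (μ.restrict (Z ⁻¹' B)).map (fun ω => fun n => X n ω) with hν
  have hν_apply : ∀ s, MeasurableSet s →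
      ν s = μ (Z ⁻¹' B ∩ (fun ω => fun n => X n ω) ⁻¹' s) := fun s hs => by
    rw [hν, Measure.map_apply hXm hs, Measure.restrict_apply (hXm hs), Set.inter_comm]
  have hpres : MeasurePreserving S ν ν := by
    refine ⟨hSm, Measure.ext fun s hs => ?_⟩
    have h := congrArg (fun m : Measure (F × (ℤ → E)) => m (B ×ˢ s)) hdist
    rw [Measure.map_apply (hZ.prodMk hYm) (hB.prod hs),
      Measure.map_apply (hZ.prodMk hXm) (hB.prod hs)] at h
    have hS' : (fun ω => fun n => X n ω) ⁻¹' (S ⁻¹' s) = (fun ω => fun n => X (n + 1) ω) ⁻¹' s := by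
      rw [← Set.preimage_comp]
      congr 1
      ext ω n
      exact hS _ n
    rw [Measure.map_apply hSm hs, hν_apply _ (hSm hs), hν_apply _ hs, hS']
    exact h
  have hac : ν ≪ μ.map (fun ω => fun n => X n ω) :=
    Measure.restrict_le_self.absolutelyContinuous.map hXm
  have : IsProbabilityMeasure (μ.map (fun ω => fun n => X n ω)) :=
    Measure.isProbabilityMeasure_map hXm.aemeasurable
  obtain ⟨c, hc⟩ := herg.eq_smul_of_absolutelyContinuous hpres hac
  have hcB : μ (Z ⁻¹' B) = c := by
    simpa [hc] using (hν_apply Set.univ MeasurableSet.univ).symm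
  rw [← hν_apply A hA, hc, hcB, Measure.smul_apply, Measure.map_apply hXm hA]
  rfl
end

section
/- Let 𝒞 be a nonempty family of closed disks in ℝ² with pairwise disjoint interiors that is locally finite, i.e., every bounded subset of ℝ² intersects only finitely many of the disks. If T is a similarity of ℝ² with ratio r > 0 that maps the family 𝒞 onto itself (T sends each disk of 𝒞 to a disk of 𝒞, and every disk of 𝒞 arises this way), then r = 1; that is, T is an isometry. -/
open Metric

/-- A family of closed balls of positive radius, only finitely many of which meet any given
bounded set, is empty if it is stable under a similarity of ratio less than `1`. -/
theorem eq_empty_of_locallyFinite_of_contracting {E : Type*} [MetricSpace E] [CompleteSpace E]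
    {𝒞 : Set (E × ℝ)} (hpos : ∀ p ∈ 𝒞, 0 < p.2)
    (hlocfin : ∀ B : Set E, Bornology.IsBounded B →
      {p ∈ 𝒞 | (closedBall p.1 p.2 ∩ B).Nonempty}.Finite)
    {s : ℝ} (hs : 0 < s) (hs1 : s < 1) {S : E → E}
    (hS : ∀ x y, dist (S x) (S y) = s * dist x y)
    (hmaps : ∀ p ∈ 𝒞, (S p.1, s * p.2) ∈ 𝒞) : 𝒞 = ∅ := by
  refine Set.eq_empty_of_forall_notMem fun p hp => ?_
  have : Nonempty E := ⟨p.1⟩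
  have hc : ContractingWith ⟨s, hs.le⟩ S :=
    ⟨by exact_mod_cast hs1, LipschitzWith.of_dist_le_mul fun x y => (hS x y).le⟩
  set z := ContractingWith.fixedPoint S hc
  have hz : S z = z := hc.fixedPoint_isFixedPt
  have hmem : ∀ n : ℕ, (S^[n] p.1, s ^ n * p.2) ∈ 𝒞 := by
    intro n
    induction n with
    | zero => simpa using hp
    | succ n ih =>
      have h := hmaps _ ih
      rwa [← mul_assoc, ← pow_succ', ← Function.iterate_succ_apply' S n p.1] at h
  have hdist : ∀ n : ℕ, dist (S^[n] p.1) z ≤ dist p.1 z := by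
    intro n
    induction n with
    | zero => simp
    | succ n ih =>
      calc dist (S^[n + 1] p.1) z = s * dist (S^[n] p.1) z := by
            rw [Function.iterate_succ_apply', ← hS, hz]
        _ ≤ dist (S^[n] p.1) z := mul_le_of_le_one_left dist_nonneg hs1.le
        _ ≤ dist p.1 z := ih
  refine Set.infinite_of_injective_forall_mem (f := fun n : ℕ => (S^[n] p.1, s ^ n * p.2))
    ?_ ?_ (hlocfin (closedBall z (dist p.1 z)) isBounded_closedBall)
  · intro m n hmn
    exact pow_right_injective₀ hs hs1.ne
      (mul_right_cancel₀ (hpos p hp).ne' (congrArg Prod.snd hmn))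
  · exact fun n => ⟨hmem n, S^[n] p.1, mem_closedBall_self (hpos _ (hmem n)).le, hdist n⟩

/-- Let `𝒞` be a nonempty, locally finite family of closed disks in `ℝ²`
(given by their centers and positive radii) with pairwise disjoint interiors. If `T` is a
similarity of `ℝ²` with ratio `r > 0` mapping the family onto itself (recalling that `T`
sends the closed disk of center `c` and radius `ρ` to the closed disk of center `T c` and
radius `r·ρ`), then `r = 1`, i.e. `T` is an isometry. -/
theorem similarity_preserving_locally_finite_packing_is_isometry
    (𝒞 : Set (EuclideanSpace ℝ (Fin 2) × ℝ))
    (hne : 𝒞.Nonempty)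
    (hpos : ∀ p ∈ 𝒞, 0 < p.2)
    (hdisj : ∀ p ∈ 𝒞, ∀ q ∈ 𝒞, p ≠ q →
      Disjoint (interior (closedBall p.1 p.2)) (interior (closedBall q.1 q.2)))
    (hlocfin : ∀ B : Set (EuclideanSpace ℝ (Fin 2)), Bornology.IsBounded B →
      {p ∈ 𝒞 | (closedBall p.1 p.2 ∩ B).Nonempty}.Finite)
    (r : ℝ) (hr : 0 < r)
    (T : EuclideanSpace ℝ (Fin 2) → EuclideanSpace ℝ (Fin 2))
    (hsurj : Function.Surjective T)
    (hT : ∀ x y, dist (T x) (T y) = r * dist x y)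
    (hmaps : ∀ p ∈ 𝒞, (T p.1, r * p.2) ∈ 𝒞)
    (honto : ∀ q ∈ 𝒞, ∃ p ∈ 𝒞, (T p.1, r * p.2) = q) :
    r = 1 := by
  rcases lt_trichotomy r 1 with h | h | h
  · exact (hne.ne_empty (eq_empty_of_locallyFinite_of_contracting hpos hlocfin hr h hT hmaps)).elim
  · exact h
  · have hinj : Function.Injective T := fun x y hxy => by
      have := hT x y
      rw [hxy, dist_self, eq_comm, mul_eq_zero] at this
      exact dist_eq_zero.mp (this.resolve_left hr.ne')
    have hright := Function.rightInverse_surjInv hsurj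
    have hleft := Function.leftInverse_surjInv ⟨hinj, hsurj⟩
    refine (hne.ne_empty (eq_empty_of_locallyFinite_of_contracting hpos hlocfin
      (inv_pos.mpr hr) (inv_lt_one_of_one_lt₀ h) (S := Function.surjInv hsurj) ?_ ?_)).elim
    · intro x y
      rw [eq_inv_mul_iff_mul_eq₀ hr.ne', ← hT, hright, hright]
    · intro q hq
      obtain ⟨p, hp, rfl⟩ := honto q hq
      simpa only [hleft p.1, inv_mul_cancel_left₀ hr.ne'] using hp
end

section
/- Let G be a connected simple graph and let C be a circle packing of G in ℝ²: an assignment of a closed disk C_v to each vertex v such that the disks have pairwise disjoint interiors and two disks are tangent if and only if the corresponding vertices are adjacent; assume the family {C_v : v ∈ V(G)} is locally finite. Suppose circle packings of G are unique up to similarity: for every other circle packing C' of G whose family of disks is locally finite, there exists a similarity T of ℝ² with T(C_v) = C'_v for all v. Then for every graph automorphism τ of G there exists an isometry T of ℝ² such that T(C_v) = C_{τ(v)} for all vertices v. -/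
open Metric

/-- A (locally finite) circle packing of a simple graph `G` in the Euclidean plane:
an assignment of a closed disk (given by center and positive radius) to each vertex,
such that the disks have pairwise disjoint interiors, two disks are tangent (their
interiors are disjoint — automatic here — and their boundary circles meet) if and only
if the corresponding vertices are adjacent, and every bounded subset of the plane meets
only finitely many of the disks. -/
structure CirclePacking {V : Type*} (G : SimpleGraph V) where
  center : V → EuclideanSpace ℝ (Fin 2)
  radius : V → ℝ
  radius_pos : ∀ v, 0 < radius v
  disjoint_interiors : ∀ u v, u ≠ v →
    Disjoint (interior (closedBall (center u) (radius u)))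
      (interior (closedBall (center v) (radius v)))
  tangent_iff_adj : ∀ u v, u ≠ v →
    ((sphere (center u) (radius u) ∩ sphere (center v) (radius v)).Nonempty ↔ G.Adj u v)
  locallyFinite : ∀ B : Set (EuclideanSpace ℝ (Fin 2)), Bornology.IsBounded B →
    {v | (closedBall (center v) (radius v) ∩ B).Nonempty}.Finite

namespace CirclePacking

variable {V W : Type*} {G : SimpleGraph V} {H : SimpleGraph W}

/-- The circle packing of `G` obtained by relabelling a circle packing of `H` along a graph
isomorphism. -/
def comap (C : CirclePacking H) (e : G ≃g H) : CirclePacking G where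
  center v := C.center (e v)
  radius v := C.radius (e v)
  radius_pos v := C.radius_pos (e v)
  disjoint_interiors _ _ huv := C.disjoint_interiors _ _ (e.injective.ne huv)
  tangent_iff_adj _ _ huv :=
    (C.tangent_iff_adj _ _ (e.injective.ne huv)).trans e.map_adj_iff
  locallyFinite B hB := Set.Finite.preimage (f := e) e.injective.injOn (C.locallyFinite B hB)

/-- A self-map of a nonempty locally finite circle packing that scales distances between centers
and radii by a common ratio cannot contract. -/
theorem one_le_of_scales [Nonempty V] (C : CirclePacking G) (f : V → V) {r : ℝ} (hr : 0 < r)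
    (hdist : ∀ u v, dist (C.center (f u)) (C.center (f v)) = r * dist (C.center u) (C.center v))
    (hrad : ∀ v, C.radius (f v) = r * C.radius v) : 1 ≤ r := by
  by_contra! hlt
  obtain ⟨v⟩ := ‹Nonempty V›
  have hradius (n : ℕ) : C.radius (f^[n] v) = r ^ n * C.radius v := by
    induction n with
    | zero => simp
    | succ n ih => rw [Function.iterate_succ_apply', hrad, ih, pow_succ']; ring
  have hstep (n : ℕ) : dist (C.center (f^[n] v)) (C.center (f^[n + 1] v)) =
      dist (C.center v) (C.center (f v)) * r ^ n := by
    induction n with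
    | zero => simp
    | succ n ih =>
      rw [Function.iterate_succ_apply', Function.iterate_succ_apply' f (n + 1), hdist, ih,
        pow_succ']
      ring
  have hbounded : Bornology.IsBounded (Set.range fun n ↦ C.center (f^[n] v)) :=
    (cauchySeq_of_le_geometric r _ hlt fun n ↦ (hstep n).le).isBounded_range
  have hinj : Function.Injective fun n : ℕ ↦ f^[n] v := by
    intro m n hmn
    have h : r ^ m * C.radius v = r ^ n * C.radius v := by
      rw [← hradius, ← hradius]
      exact congrArg C.radius hmn
    exact pow_right_injective₀ hr hlt.ne (mul_right_cancel₀ (C.radius_pos v).ne' h)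
  refine Set.infinite_range_of_injective hinj ((C.locallyFinite _ hbounded).subset ?_)
  rintro _ ⟨n, rfl⟩
  exact ⟨_, mem_closedBall_self (C.radius_pos _).le, n, rfl⟩

end CirclePacking

/-- Let `G` be a connected simple graph with a (locally finite) circle
packing `C` in `ℝ²`, and suppose circle packings of `G` are unique up to similarity: for
every other locally finite circle packing `C'` of `G` there is a similarity `T` of `ℝ²`
(a surjective map scaling all distances by some ratio `r > 0`) carrying each disk `C_v`
to `C'_v` (i.e. `T` sends the center of `C_v` to the center of `C'_v` and multiplies its
radius by `r`). Then every graph automorphism `τ` of `G` is represented by an isometry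
`T` of `ℝ²` with `T(C_v) = C_{τ(v)}` for all `v`. -/
theorem automorphism_represented_by_isometry
    {V : Type*} (G : SimpleGraph V) (hconn : G.Connected)
    (C : CirclePacking G)
    (huniq : ∀ C' : CirclePacking G,
      ∃ (T : EuclideanSpace ℝ (Fin 2) → EuclideanSpace ℝ (Fin 2)) (r : ℝ), 0 < r ∧
        Function.Surjective T ∧
        (∀ x y, dist (T x) (T y) = r * dist x y) ∧
        (∀ v, T (C.center v) = C'.center v ∧ r * C.radius v = C'.radius v)) :
    ∀ τ : G ≃g G,
      ∃ T : EuclideanSpace ℝ (Fin 2) → EuclideanSpace ℝ (Fin 2),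
        Function.Surjective T ∧
        (∀ x y, dist (T x) (T y) = dist x y) ∧
        (∀ v, T (C.center v) = C.center (τ v) ∧ C.radius (τ v) = C.radius v) := by
  intro τ
  have := hconn.nonempty
  obtain ⟨T, r, hr, hsurj, hdist, hT⟩ := huniq (C.comap τ)
  have hcenter (v : V) : T (C.center v) = C.center (τ v) := (hT v).1
  have hradius (v : V) : C.radius (τ v) = r * C.radius v := (hT v).2.symm
  have hle : 1 ≤ r := C.one_le_of_scales τ hr
    (fun u v ↦ by rw [← hcenter, ← hcenter, hdist]) hradius
  have hge : 1 ≤ r⁻¹ := by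
    refine C.one_le_of_scales τ.symm (inv_pos.2 hr) (fun u v ↦ ?_) fun v ↦ ?_
    · rw [eq_inv_mul_iff_mul_eq₀ hr.ne', ← hdist, hcenter, hcenter, τ.apply_symm_apply,
        τ.apply_symm_apply]
    · rw [eq_inv_mul_iff_mul_eq₀ hr.ne', ← hradius, τ.apply_symm_apply]
  obtain rfl : r = 1 := le_antisymm ((one_le_inv₀ hr).1 hge) hle
  exact ⟨T, hsurj, fun x y ↦ by rw [hdist, one_mul], fun v ↦
    ⟨hcenter v, by rw [hradius, one_mul]⟩⟩
end
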